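/- arXiv:1312.6282 — 3 statements merged into one kernel-verified Lean document; each statement's English description precedes it below -/
import Mathlib

section
/- Let p be a stochastic language admitting a d-dimensional linear representation ⟨I, M, T⟩, let η ∈ [0,1], and suppose the matrix series ∑_{n≥0} ηⁿ·M_Σⁿ converges with sum (I_d − η·M_Σ)^{-1}. Set Î_η = (I_d − η·M_Σᵀ)^{-1}·I and T̄_η = (I_d − η·M_Σ)^{-1}·T. Then for every u ∈ Σ*, p̂_η(u) = Î_ηᵀ·M(u)·T̄_η; in particular p̂_η is rational with linear representation ⟨Î_η, M, T̄_η⟩. -/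
open Matrix

/-- Pairs of words, sorted by the lengths of both words. -/
def wordPairEquiv (α : Type*) :
    (Σ k : ℕ × ℕ, (Fin k.1 → α) × (Fin k.2 → α)) ≃ List α × List α :=
  Equiv.trans
    { toFun := fun s => ((⟨s.1.1, s.2.1⟩, ⟨s.1.2, s.2.2⟩) : (Σ n, Fin n → α) × (Σ n, Fin n → α))
      invFun := fun q => ⟨(q.1.1, q.2.1), (q.1.2, q.2.2)⟩
      left_inv := fun _ => rfl
      right_inv := fun _ => rfl }
    (Equiv.prodCongr List.equivSigmaTuple.symm List.equivSigmaTuple.symm)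

/-- Summing a monoid morphism over all words of length `n` gives the `n`-th power of its sum over
the letters. -/
theorem sum_ofFn_eq_pow {α R : Type*} [Fintype α] [Semiring R] (M : List α → R)
    (hM1 : M [] = 1) (hMmul : ∀ u v : List α, M (u ++ v) = M u * M v) (n : ℕ) :
    ∑ x : Fin n → α, M (List.ofFn x) = (∑ a : α, M [a]) ^ n := by
  induction n with
  | zero => simp [hM1]
  | succ n ih =>
    rw [← (Fin.consEquiv fun _ : Fin (n + 1) => α).sum_comp, Fintype.sum_prod_type, pow_succ', ← ih,
      Finset.sum_mul_sum]
    refine Finset.sum_congr rfl fun a _ => Finset.sum_congr rfl fun x _ => ?_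
    rw [← hMmul]
    simp [Fin.consEquiv, List.ofFn_succ]

/-- A nonnegative function on pairs of words can be summed by first summing over all pairs of words
of given lengths. -/
theorem hasSum_of_hasSum_wordPair {α : Type*} [Fintype α] {f : List α × List α → ℝ}
    (hf : ∀ z, 0 ≤ f z) {a : ℝ}
    (h : HasSum (fun k : ℕ × ℕ =>
      ∑ x : Fin k.1 → α, ∑ y : Fin k.2 → α, f (List.ofFn x, List.ofFn y)) a) :
    HasSum f a := by
  rw [← (wordPairEquiv α).hasSum_iff]
  have hfib : ∀ k : ℕ × ℕ, HasSum (fun c => (f ∘ wordPairEquiv α) ⟨k, c⟩)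
      (∑ x : Fin k.1 → α, ∑ y : Fin k.2 → α, f (List.ofFn x, List.ofFn y)) := fun k => by
    have := hasSum_fintype fun c => (f ∘ wordPairEquiv α) ⟨k, c⟩
    rwa [Fintype.sum_prod_type] at this
  have hs : Summable (f ∘ wordPairEquiv α) := by
    refine (summable_sigma_of_nonneg fun _ => hf _).2 ⟨fun k => (hfib k).summable, ?_⟩
    exact h.summable.congr fun k => (hfib k).tsum_eq.symm
  exact (hs.hasSum.sigma hfib).unique h ▸ hs.hasSum

theorem HasSum.dotProduct_prod {ι κ n : Type*} [Fintype n] {v : ι → n → ℝ} {w : κ → n → ℝ}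
    {a b : n → ℝ} (hv : HasSum v a) (hw : HasSum w b) :
    HasSum (fun k : ι × κ => v k.1 ⬝ᵥ w k.2) (a ⬝ᵥ b) := by
  refine hasSum_sum fun i _ => ?_
  have hvi := Pi.hasSum.1 hv i
  have hwi := Pi.hasSum.1 hw i
  exact hvi.mul hwi (summable_mul_of_summable_norm hvi.summable.norm hwi.summable.norm)

/-- if `p` is a stochastic language with `d`-dimensional linear representation
`⟨I, M, T⟩`, `η ∈ [0,1]`, and the matrix series `∑ₙ ηⁿ·M_Σⁿ` converges with sum
`(I_d − η·M_Σ)⁻¹`, then with `Î_η = (I_d − η·M_Σᵀ)⁻¹·I` and `T̄_η = (I_d − η·M_Σ)⁻¹·T`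
one has, for every `u ∈ Σ*`, `p̂_η(u) = Î_ηᵀ·M(u)·T̄_η`, i.e. `⟨Î_η, M, T̄_η⟩` is a
linear representation of `p̂_η`. -/
theorem smoothed_factor_rational {α : Type*} [Fintype α] [DecidableEq α]
    (p : List α → ℝ) (hp0 : ∀ w, 0 ≤ p w) (hp1 : HasSum p 1)
    {d : ℕ} (I T : Fin d → ℝ) (M : List α → Matrix (Fin d) (Fin d) ℝ)
    (hM1 : M [] = 1) (hMmul : ∀ u v : List α, M (u ++ v) = M u * M v)
    (hrep : ∀ u : List α, p u = I ⬝ᵥ (M u *ᵥ T))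
    (η : ℝ) (hη0 : 0 ≤ η) (hη1 : η ≤ 1)
    (Msig : Matrix (Fin d) (Fin d) ℝ) (hMsig : Msig = ∑ x : α, M [x])
    (hconv : HasSum (fun n : ℕ => η ^ n • Msig ^ n) (1 - η • Msig)⁻¹) :
    ∀ u : List α,
      (∑' z : List α × List α, η ^ (z.1.length + z.2.length) * p (z.1 ++ u ++ z.2)) =
        ((1 - η • Msigᵀ)⁻¹ *ᵥ I) ⬝ᵥ (M u *ᵥ ((1 - η • Msig)⁻¹ *ᵥ T)) := by
  intro u
  have hT : HasSum (fun n : ℕ => M u *ᵥ ((η ^ n • Msig ^ n) *ᵥ T))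
      (M u *ᵥ ((1 - η • Msig)⁻¹ *ᵥ T)) :=
    hconv.map ((Matrix.mulVecLin (M u)).toAddMonoidHom.comp
        (((Matrix.mulVecBilin ℝ ℝ).flip T).toAddMonoidHom))
      (by
        change Continuous fun A : Matrix (Fin d) (Fin d) ℝ => M u *ᵥ (A *ᵥ T)
        fun_prop)
  have hI : HasSum (fun n : ℕ => I ᵥ* (η ^ n • Msig ^ n)) ((1 - η • Msigᵀ)⁻¹ *ᵥ I) := by
    have htr : (1 - η • Msigᵀ)⁻¹ = ((1 - η • Msig)⁻¹)ᵀ := by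
      rw [Matrix.transpose_nonsing_inv]
      simp
    rw [htr, Matrix.mulVec_transpose]
    exact hconv.map (Matrix.vecMulBilin ℝ ℝ I).toAddMonoidHom
      (by
        change Continuous fun A : Matrix (Fin d) (Fin d) ℝ => I ᵥ* A
        fun_prop)
  refine (hasSum_of_hasSum_wordPair (fun z => mul_nonneg (pow_nonneg hη0 _) (hp0 _)) ?_).tsum_eq
  convert hI.dotProduct_prod hT using 1
  ext ⟨m, n⟩
  have hsig : ∀ n : ℕ, Msig ^ n = ∑ x : Fin n → α, M (List.ofFn x) := fun n => by
    rw [hMsig, sum_ofFn_eq_pow M hM1 hMmul]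
  simp only [List.length_ofFn, hrep, hMmul, hsig, ← Matrix.dotProduct_mulVec,
    ← Matrix.mulVec_mulVec, Matrix.smul_mulVec, Matrix.mulVec_smul, Matrix.vecMul_smul,
    smul_dotProduct, dotProduct_smul, smul_eq_mul, Matrix.sum_mulVec, Matrix.mulVec_sum,
    dotProduct_sum, Finset.mul_sum, pow_add]
  rw [Finset.sum_comm]
  refine Finset.sum_congr rfl fun _ _ => Finset.sum_congr rfl fun _ _ => ?_
  ring
end

section
/- Let p be a stochastic language, let 0 ≤ η < 1, let U, V be finite subsets of Σ*, and for a string w ∈ Σ* let Z̄_{η,w} be the U×V matrix Z̄_{η,w}[u,v] = ∑_{x∈Σ*} η^{|x|}·(1_{w=uvx} − p(uvx)). Then for every w ∈ Σ*: ‖Z̄_{η,w}‖_∞ ≤ 1/(1−η) + S_{p̄_η}^{(1)}, ‖Z̄_{η,w}‖₁ ≤ 1/(1−η) + S_{p̄_η}^{(1)}, and hence ‖Z̄_{η,w}‖₂ ≤ 1/(1−η) + S_{p̄_η}^{(1)}. -/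
open Matrix

/-- The spectral norm (largest singular value) of a real matrix. -/
noncomputable def specNorm {m n : Type*} [Fintype m] [Fintype n] [DecidableEq n]
    (M : Matrix m n ℝ) : ℝ :=
  ‖(Matrix.toEuclideanLin M).toContinuousLinearMap‖

/-- The maximum absolute row sum norm `‖M‖_∞`. -/
noncomputable def rowSumNorm {m n : Type*} [Fintype n] (M : Matrix m n ℝ) : ℝ :=
  ⨆ i, ∑ j, |M i j|

/-- The maximum absolute column sum norm `‖M‖₁`. -/
noncomputable def colSumNorm {m n : Type*} [Fintype m] (M : Matrix m n ℝ) : ℝ :=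
  ⨆ j, ∑ i, |M i j|

/-- The `η`-smoothed prefix function `u ↦ ∑_x η^{|x|}·f(ux)` of a function `f` on strings. -/
noncomputable def smoothedPrefix {α : Type*} (η : ℝ) (f : List α → ℝ) (u : List α) : ℝ :=
  ∑' x : List α, η ^ x.length * f (u ++ x)

lemma injective_length_append (α : Type*) :
    Function.Injective (fun y : List α × List α => (y.2.length, y.1 ++ y.2)) := by
  rintro ⟨u, x⟩ ⟨u', x'⟩ h
  simp only [Prod.mk.injEq] at h
  obtain ⟨h1, h2⟩ := h
  obtain ⟨rfl, rfl⟩ := List.append_inj' h2 h1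
  rfl

lemma hasSum_pow_mul {α : Type*} {η : ℝ} (hη0 : 0 ≤ η) (hη1 : η < 1) {f : List α → ℝ}
    (hf0 : ∀ w, 0 ≤ f w) {s : ℝ} (hf : HasSum f s) :
    HasSum (fun y : ℕ × List α => η ^ y.1 * f y.2) ((1 - η)⁻¹ * s) := by
  have hg := hasSum_geometric_of_lt_one hη0 hη1
  exact hg.mul hf (hg.summable.mul_of_nonneg hf.summable (fun n => pow_nonneg hη0 n) hf0)

lemma summable_pow_length_mul {α : Type*} {η : ℝ} (hη0 : 0 ≤ η) (hη1 : η < 1) {f : List α → ℝ}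
    (hf0 : ∀ w, 0 ≤ f w) (hf : Summable f) :
    Summable (fun y : List α × List α => η ^ y.2.length * f (y.1 ++ y.2)) := by
  have h := (hasSum_pow_mul hη0 hη1 hf0 hf.hasSum).summable
  simpa only [Function.comp_def] using h.comp_injective (injective_length_append α)

lemma smoothedPrefix_nonneg {α : Type*} {η : ℝ} (hη0 : 0 ≤ η) {f : List α → ℝ}
    (hf0 : ∀ w, 0 ≤ f w) (u : List α) : 0 ≤ smoothedPrefix η f u :=
  tsum_nonneg fun _ => mul_nonneg (pow_nonneg hη0 _) (hf0 _)

lemma summable_smoothedPrefix {α : Type*} {η : ℝ} (hη0 : 0 ≤ η) (hη1 : η < 1) {f : List α → ℝ}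
    (hf0 : ∀ w, 0 ≤ f w) (hf : Summable f) : Summable (smoothedPrefix η f) :=
  (summable_pow_length_mul hη0 hη1 hf0 hf).prod

lemma tsum_smoothedPrefix_le {α : Type*} {η : ℝ} (hη0 : 0 ≤ η) (hη1 : η < 1) {f : List α → ℝ}
    (hf0 : ∀ w, 0 ≤ f w) {s : ℝ} (hf : HasSum f s) :
    ∑' u, smoothedPrefix η f u ≤ (1 - η)⁻¹ * s := by
  have hs := summable_pow_length_mul hη0 hη1 hf0 hf.summable
  have hp := hasSum_pow_mul hη0 hη1 hf0 hf
  calc ∑' u, smoothedPrefix η f u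
      = ∑' y : List α × List α, η ^ y.2.length * f (y.1 ++ y.2) := hs.tsum_prod.symm
    _ ≤ ∑' y : ℕ × List α, η ^ y.1 * f y.2 :=
        hs.tsum_le_tsum_of_inj _ (injective_length_append α)
          (fun y _ => mul_nonneg (pow_nonneg hη0 _) (hf0 _)) (fun _ => le_rfl) hp.summable
    _ = (1 - η)⁻¹ * s := hp.tsum_eq

lemma sum_comp_le_tsum {ι κ : Type*} [Fintype ι] {e : ι → κ} (he : Function.Injective e)
    {G : κ → ℝ} (hG0 : ∀ k, 0 ≤ G k) (hG : Summable G) : ∑ i, G (e i) ≤ ∑' k, G k := by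
  simpa using hG.sum_le_tsum (Finset.univ.map ⟨e, he⟩) (fun k _ => hG0 k)

/-- Schur test: a common bound on the absolute row and column sums bounds the spectral norm. -/
lemma specNorm_le_of_sum_abs_le {m n : Type*} [Fintype m] [Fintype n] [DecidableEq n]
    (M : Matrix m n ℝ) {B : ℝ} (hB : 0 ≤ B) (hrow : ∀ i, ∑ j, |M i j| ≤ B)
    (hcol : ∀ j, ∑ i, |M i j| ≤ B) : specNorm M ≤ B := by
  refine ContinuousLinearMap.opNorm_le_bound _ hB fun x => ?_
  refine le_of_sq_le_sq ?_ (by positivity)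
  rw [mul_pow, EuclideanSpace.real_norm_sq_eq, EuclideanSpace.real_norm_sq_eq]
  have entry (i : m) : (∑ j, M i j * x j) ^ 2 ≤ B * ∑ j, |M i j| * x j ^ 2 := by
    calc (∑ j, M i j * x j) ^ 2
        ≤ (∑ j, |M i j|) * ∑ j, |M i j| * x j ^ 2 :=
          Finset.sum_sq_le_sum_mul_sum_of_sq_le_mul _ (fun j _ => abs_nonneg _)
            (fun j _ => by positivity) (fun j _ => (by rw [mul_pow, ← sq_abs (M i j)]; ring : _ = _).le)
      _ ≤ B * ∑ j, |M i j| * x j ^ 2 := by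
          gcongr
          exact hrow i
  calc ∑ i, ((Matrix.toEuclideanLin M).toContinuousLinearMap x) i ^ 2
      = ∑ i, (∑ j, M i j * x j) ^ 2 := by
        simp [Matrix.toLpLin_apply, Matrix.mulVec, dotProduct]
    _ ≤ ∑ i, B * ∑ j, |M i j| * x j ^ 2 := Finset.sum_le_sum fun i _ => entry i
    _ = B * ∑ j, (∑ i, |M i j|) * x j ^ 2 := by
        rw [← Finset.mul_sum, Finset.sum_comm]
        simp_rw [Finset.sum_mul]
    _ ≤ B * ∑ j, B * x j ^ 2 := by
        gcongr with j
        exact hcol j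
    _ = B ^ 2 * ∑ j, x j ^ 2 := by
        rw [← Finset.mul_sum]
        ring

/-- for a stochastic language `p`, `0 ≤ η < 1`, finite `U, V ⊆ Σ*` and
`w ∈ Σ*`, the `U × V` matrix `Z̄_{η,w}[u,v] = ∑_x η^{|x|}·(1_{w=uvx} − p(uvx))`
satisfies `‖Z̄_{η,w}‖_∞ ≤ 1/(1−η) + S_{p̄_η}⁽¹⁾`, `‖Z̄_{η,w}‖₁ ≤ 1/(1−η) + S_{p̄_η}⁽¹⁾`
and `‖Z̄_{η,w}‖₂ ≤ 1/(1−η) + S_{p̄_η}⁽¹⁾`, where `S_{p̄_η}⁽¹⁾ = ∑_u ∑_x η^{|x|}·p(ux)`. -/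
theorem prefix_hankel_summand_norm_bound {α : Type*} [Fintype α] [DecidableEq α]
    (p : List α → ℝ) (hp0 : ∀ w, 0 ≤ p w) (hp1 : HasSum p 1)
    (η : ℝ) (hη0 : 0 ≤ η) (hη1 : η < 1)
    (U V : Finset (List α)) (w : List α)
    (Z : Matrix ↥U ↥V ℝ)
    (hZ : ∀ (u : ↥U) (v : ↥V), Z u v =
      ∑' x : List α, η ^ x.length *
        ((if w = ↑u ++ ↑v ++ x then 1 else 0) - p (↑u ++ ↑v ++ x))) :
    rowSumNorm Z ≤ 1 / (1 - η) + (∑' u : List α, ∑' x : List α, η ^ x.length * p (u ++ x)) ∧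
    colSumNorm Z ≤ 1 / (1 - η) + (∑' u : List α, ∑' x : List α, η ^ x.length * p (u ++ x)) ∧
    specNorm Z ≤ 1 / (1 - η) + (∑' u : List α, ∑' x : List α, η ^ x.length * p (u ++ x)) := by
  set B := 1 / (1 - η) + ∑' u : List α, ∑' x : List α, η ^ x.length * p (u ++ x)
  let δ : List α → ℝ := fun z => if w = z then 1 else 0
  have hδ0 : ∀ z, 0 ≤ δ z := fun z => by
    simp only [δ]
    split_ifs <;> norm_num
  have hδ : HasSum δ 1 := by
    simpa [δ, eq_comm] using hasSum_ite_eq w (1 : ℝ)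
  have hsδ := summable_smoothedPrefix hη0 hη1 hδ0 hδ.summable
  have hsp := summable_smoothedPrefix hη0 hη1 hp0 hp1.summable
  let G : List α → ℝ := fun u => smoothedPrefix η δ u + smoothedPrefix η p u
  have hG0 : ∀ u, 0 ≤ G u := fun u =>
    add_nonneg (smoothedPrefix_nonneg hη0 hδ0 u) (smoothedPrefix_nonneg hη0 hp0 u)
  have hG : Summable G := hsδ.add hsp
  have hGB : ∑' u, G u ≤ B := by
    rw [hsδ.tsum_add hsp]
    have h := tsum_smoothedPrefix_le hη0 hη1 hδ0 hδ
    rw [mul_one, ← one_div] at h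
    exact add_le_add h le_rfl
  have hB : 0 ≤ B := (tsum_nonneg hG0).trans hGB
  have hZG (u : ↥U) (v : ↥V) : |Z u v| ≤ G (↑u ++ ↑v) := by
    have h : Z u v = smoothedPrefix η δ (↑u ++ ↑v) - smoothedPrefix η p (↑u ++ ↑v) := by
      rw [hZ]
      simp only [mul_sub]
      exact ((summable_pow_length_mul hη0 hη1 hδ0 hδ.summable).prod_factor _).tsum_sub
        ((summable_pow_length_mul hη0 hη1 hp0 hp1.summable).prod_factor _)
    rw [h]
    refine (abs_sub _ _).trans_eq ?_
    rw [abs_of_nonneg (smoothedPrefix_nonneg hη0 hδ0 _),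
      abs_of_nonneg (smoothedPrefix_nonneg hη0 hp0 _)]
  have hrow (u : ↥U) : ∑ v, |Z u v| ≤ B :=
    (Finset.sum_le_sum fun v _ => hZG u v).trans <|
      (sum_comp_le_tsum (e := fun v : ↥V => (u : List α) ++ v)
        (fun v v' h => Subtype.ext (List.append_cancel_left h)) hG0 hG).trans hGB
  have hcol (v : ↥V) : ∑ u, |Z u v| ≤ B :=
    (Finset.sum_le_sum fun u _ => hZG u v).trans <|
      (sum_comp_le_tsum (e := fun u : ↥U => (u : List α) ++ v)
        (fun u u' h => Subtype.ext (List.append_cancel_right h)) hG0 hG).trans hGB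
  exact ⟨Real.iSup_le hrow hB, Real.iSup_le hcol hB, specNorm_le_of_sum_abs_le Z hB hrow hcol⟩
end

section
/- Let p be a stochastic language, let 0 < η < 1, let ξ be a random string distributed according to p, and let Ẑ_η be the random bi-infinite matrix with entries Ẑ_η[u,v] = ∑_{x,y∈Σ*} η^{|x|+|y|}·(1_{ξ=xuvy} − p(xuvy)) for u, v ∈ Σ*. Then for any strings u, u', v ∈ Σ*: |E(Ẑ_η[u,v]·Ẑ_η[u',v])| ≤ K_η·∑_{x',y'∈Σ*} η^{|x'|+|y'|}·p(x'u'vy') = K_η·p̂_η(u'v). -/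
open MeasureTheory

/-- `K_η = 1` if `η ≤ e⁻¹`, and `K_η = (−e·η·ln η)⁻¹` otherwise. -/
noncomputable def Keta (η : ℝ) : ℝ :=
  if η ≤ (Real.exp 1)⁻¹ then 1 else (-(Real.exp 1 * η * Real.log η))⁻¹

lemma succ_mul_pow_le_Keta {η : ℝ} (hη0 : 0 < η) (hη1 : η < 1) (n : ℕ) :
    ((n : ℝ) + 1) * η ^ n ≤ Keta η := by
  unfold Keta
  split_ifs with h
  · have h1 : (n : ℝ) + 1 ≤ Real.exp 1 ^ n := by
      rw [← Real.exp_nat_mul, mul_one]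
      exact Real.add_one_le_exp _
    calc ((n : ℝ) + 1) * η ^ n ≤ Real.exp 1 ^ n * (Real.exp 1)⁻¹ ^ n := by gcongr
      _ = 1 := by rw [← mul_pow, mul_inv_cancel₀ (Real.exp_pos 1).ne', one_pow]
  · have hL : Real.log η < 0 := Real.log_neg hη0 hη1
    have hpos : 0 < -(Real.exp 1 * η * Real.log η) := by
      have := mul_pos (mul_pos (Real.exp_pos 1) hη0) (neg_pos.2 hL)
      linarith
    rw [← one_div, le_div_iff₀ hpos]
    have hpow : η ^ (n + 1) = Real.exp (((n : ℝ) + 1) * Real.log η) := by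
      have := Real.exp_nat_mul (Real.log η) (n + 1)
      rw [Real.exp_log hη0] at this
      rw [← this]
      push_cast
      rfl
    have key : -(((n : ℝ) + 1) * Real.log η) ≤ Real.exp (-(((n : ℝ) + 1) * Real.log η) - 1) := by
      have := Real.add_one_le_exp (-(((n : ℝ) + 1) * Real.log η) - 1)
      linarith
    calc ((n : ℝ) + 1) * η ^ n * -(Real.exp 1 * η * Real.log η)
        = -(((n : ℝ) + 1) * Real.log η) * (Real.exp 1 * η ^ (n + 1)) := by ring
      _ ≤ Real.exp (-(((n : ℝ) + 1) * Real.log η) - 1) * (Real.exp 1 * η ^ (n + 1)) := by gcongr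
      _ = 1 := by
        rw [hpow, ← Real.exp_add, ← Real.exp_add, ← Real.exp_zero]
        ring_nf

/-- The damped number of occurrences of any factor in a word is at most `K_η`. -/
lemma sum_occurrences_le_Keta {α : Type*} [DecidableEq α] {η : ℝ} (hη0 : 0 < η) (hη1 : η < 1)
    (u v w : List α) (s : Finset (List α × List α)) :
    ∑ z ∈ s, η ^ (z.1.length + z.2.length) *
      (if w = z.1 ++ u ++ v ++ z.2 then (1 : ℝ) else 0) ≤ Keta η := by
  classical
  simp only [mul_ite, mul_one, mul_zero]
  rw [← Finset.sum_filter]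
  set S := s.filter fun z => w = z.1 ++ u ++ v ++ z.2 with hS
  set n := w.length - (u.length + v.length) with hn
  have hlen : ∀ z ∈ S, z.1.length + z.2.length = n := by
    intro z hz
    have h := congrArg List.length (Finset.mem_filter.1 hz).2
    simp only [List.length_append] at h
    omega
  have hcard : S.card ≤ n + 1 := by
    rw [← Finset.card_range (n + 1)]
    refine Finset.card_le_card_of_injOn (fun z => z.1.length) ?_ ?_
    · intro z hz
      have := hlen z hz
      simp only [Finset.coe_range, Set.mem_Iio]
      omega
    · intro z hz z' hz' hzz
      have h := (Finset.mem_filter.1 hz).2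
      rw [(Finset.mem_filter.1 hz').2] at h
      simp only [List.append_assoc] at h
      obtain ⟨h1, h2⟩ := List.append_inj h hzz.symm
      exact Prod.ext h1.symm (List.append_cancel_left (List.append_cancel_left h2)).symm
  calc ∑ z ∈ S, η ^ (z.1.length + z.2.length) = S.card * η ^ n := by
        rw [Finset.sum_congr rfl fun z hz => by rw [hlen z hz], Finset.sum_const, nsmul_eq_mul]
    _ ≤ ((n : ℝ) + 1) * η ^ n := by
        gcongr
        exact_mod_cast hcard
    _ ≤ Keta η := succ_mul_pow_le_Keta hη0 hη1 n

/-- The covariance of two nonnegative random variables bounded by `K` is at most `K` times the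
mean of the second one. -/
lemma abs_integral_centered_mul_le {Ω : Type*} [MeasurableSpace Ω] {μ : Measure Ω}
    [IsProbabilityMeasure μ] {f g : Ω → ℝ} {K : ℝ} (hf : AEStronglyMeasurable f μ)
    (hg : AEStronglyMeasurable g μ) (hf0 : ∀ ω, 0 ≤ f ω) (hg0 : ∀ ω, 0 ≤ g ω)
    (hfK : ∀ ω, f ω ≤ K) (hgK : ∀ ω, g ω ≤ K) :
    |∫ ω, (f ω - ∫ ω, f ω ∂μ) * (g ω - ∫ ω, g ω ∂μ) ∂μ| ≤ K * ∫ ω, g ω ∂μ := by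
  have hfi : Integrable f μ := Integrable.of_bound hf K
    (.of_forall fun ω => by rw [Real.norm_of_nonneg (hf0 ω)]; exact hfK ω)
  have hgi : Integrable g μ := Integrable.of_bound hg K
    (.of_forall fun ω => by rw [Real.norm_of_nonneg (hg0 ω)]; exact hgK ω)
  have hfg : Integrable (fun ω => f ω * g ω) μ := hgi.bdd_mul hf
    (.of_forall fun ω => by rw [Real.norm_of_nonneg (hf0 ω)]; exact hfK ω)
  have ha0 : 0 ≤ ∫ ω, f ω ∂μ := integral_nonneg hf0
  have hb0 : 0 ≤ ∫ ω, g ω ∂μ := integral_nonneg hg0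
  have haK : ∫ ω, f ω ∂μ ≤ K := by
    simpa using integral_mono hfi (integrable_const K) hfK
  have hfg0 : 0 ≤ ∫ ω, f ω * g ω ∂μ := integral_nonneg fun ω => mul_nonneg (hf0 ω) (hg0 ω)
  have hfgK : ∫ ω, f ω * g ω ∂μ ≤ K * ∫ ω, g ω ∂μ := by
    rw [← integral_const_mul]
    exact integral_mono hfg (hgi.const_mul K) fun ω =>
      mul_le_mul_of_nonneg_right (hfK ω) (hg0 ω)
  set a := ∫ ω, f ω ∂μ with ha
  set b := ∫ ω, g ω ∂μ with hb
  have hcov : ∫ ω, (f ω - a) * (g ω - b) ∂μ = ∫ ω, f ω * g ω ∂μ - a * b := by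
    have hexp : ∀ ω, (f ω - a) * (g ω - b) = f ω * g ω - (b * f ω + a * g ω - a * b) :=
      fun ω => by ring
    simp_rw [hexp]
    have hlin : Integrable (fun ω => b * f ω + a * g ω) μ :=
      (hfi.const_mul b).add (hgi.const_mul a)
    have hlin' : Integrable (fun ω => b * f ω + a * g ω - a * b) μ :=
      hlin.sub (integrable_const _)
    rw [integral_sub hfg hlin', integral_sub hlin (integrable_const _),
      integral_add (hfi.const_mul b) (hgi.const_mul a), integral_const_mul, integral_const_mul,
      ← ha, ← hb]
    simp
    ring
  rw [hcov]
  exact abs_sub_le_of_nonneg_of_le hfg0 hfgK (mul_nonneg ha0 hb0)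
    (mul_le_mul_of_nonneg_right haK hb0)

/-- for a stochastic language `p`, `0 < η < 1`, a random string `ξ ∼ p` and
the random bi-infinite matrix `Ẑ_η[u,v] = ∑_{x,y} η^{|x|+|y|}·(1_{ξ=xuvy} − p(xuvy))`,
one has `|E(Ẑ_η[u,v]·Ẑ_η[u',v])| ≤ K_η·∑_{x',y'} η^{|x'|+|y'|}·p(x'u'vy') = K_η·p̂_η(u'v)`. -/
theorem factor_hankel_entry_covariance_bound {α Ω : Type*} [Fintype α] [DecidableEq α]
    [MeasurableSpace Ω] (μ : Measure Ω) [IsProbabilityMeasure μ]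
    (p : List α → ℝ) (hp0 : ∀ w, 0 ≤ p w) (hp1 : HasSum p 1)
    (η : ℝ) (hη0 : 0 < η) (hη1 : η < 1)
    (ξ : Ω → List α)
    (hmeas : ∀ w : List α, MeasurableSet {ω | ξ ω = w})
    (hdist : ∀ w : List α, μ {ω | ξ ω = w} = ENNReal.ofReal (p w))
    (Z : Ω → List α → List α → ℝ)
    (hZ : ∀ ω u v, Z ω u v =
      ∑' z : List α × List α, η ^ (z.1.length + z.2.length) *
        ((if ξ ω = z.1 ++ u ++ v ++ z.2 then 1 else 0) - p (z.1 ++ u ++ v ++ z.2))) :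
    ∀ u u' v : List α,
      |∫ ω, Z ω u v * Z ω u' v ∂μ| ≤
        Keta η * ∑' z : List α × List α,
          η ^ (z.1.length + z.2.length) * p (z.1 ++ u' ++ v ++ z.2) := by
  intro u u' v
  let F : List α → List α → ℝ := fun t w => ∑' z : List α × List α,
    η ^ (z.1.length + z.2.length) * (if w = z.1 ++ t ++ v ++ z.2 then (1 : ℝ) else 0)
  have hterm0 : ∀ (t w : List α) (z : List α × List α),
      0 ≤ η ^ (z.1.length + z.2.length) *
        (if w = z.1 ++ t ++ v ++ z.2 then (1 : ℝ) else 0) := fun t w z => by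
    split_ifs <;> positivity
  have hFsum : ∀ t w, Summable fun z : List α × List α =>
      η ^ (z.1.length + z.2.length) * (if w = z.1 ++ t ++ v ++ z.2 then (1 : ℝ) else 0) :=
    fun t w => summable_of_sum_le (hterm0 t w) (sum_occurrences_le_Keta hη0 hη1 t v w)
  have hF0 : ∀ t w, 0 ≤ F t w := fun t w => tsum_nonneg (hterm0 t w)
  have hFK : ∀ t w, F t w ≤ Keta η := fun t w =>
    Real.tsum_le_of_sum_le (hterm0 t w) (sum_occurrences_le_Keta hη0 hη1 t v w)
  have hFmeas : ∀ t, AEStronglyMeasurable (fun ω => F t (ξ ω)) μ := fun t => by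
    let _ : MeasurableSpace (List α) := ⊤
    have hξ : Measurable ξ := measurable_to_countable' hmeas
    have hF : Measurable (F t) := measurable_from_top
    exact (hF.comp hξ).aestronglyMeasurable
  have hint : ∀ t (z : List α × List α), Integrable (fun ω => η ^ (z.1.length + z.2.length) *
      (if ξ ω = z.1 ++ t ++ v ++ z.2 then (1 : ℝ) else 0)) μ := fun t z =>
    (((integrable_const (1 : ℝ)).indicator (hmeas (z.1 ++ t ++ v ++ z.2))).congr
      (.of_forall fun ω => by simp [Set.indicator_apply])).const_mul _
  have hval : ∀ t (z : List α × List α), ∫ ω, η ^ (z.1.length + z.2.length) *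
      (if ξ ω = z.1 ++ t ++ v ++ z.2 then (1 : ℝ) else 0) ∂μ =
        η ^ (z.1.length + z.2.length) * p (z.1 ++ t ++ v ++ z.2) := fun t z => by
    rw [integral_const_mul]
    congr 1
    have h := integral_indicator_one (μ := μ) (hmeas (z.1 ++ t ++ v ++ z.2))
    rw [measureReal_def, hdist, ENNReal.toReal_ofReal (hp0 _)] at h
    rw [← h]
    exact integral_congr_ae (.of_forall fun ω => by simp [Set.indicator_apply])
  have hpsum : ∀ t, Summable fun z : List α × List α =>
      η ^ (z.1.length + z.2.length) * p (z.1 ++ t ++ v ++ z.2) := fun t => by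
    refine summable_of_sum_le (c := Keta η) (fun z => mul_nonneg (by positivity) (hp0 _))
      fun s => ?_
    simp_rw [← hval]
    rw [← integral_finsetSum s fun z _ => hint t z]
    simpa using integral_mono (integrable_finsetSum s fun z _ => hint t z)
      (integrable_const (μ := μ) (Keta η)) fun ω => sum_occurrences_le_Keta hη0 hη1 t v (ξ ω) s
  have hmean : ∀ t, ∫ ω, F t (ξ ω) ∂μ = ∑' z : List α × List α,
      η ^ (z.1.length + z.2.length) * p (z.1 ++ t ++ v ++ z.2) := fun t => by
    simp_rw [← hval]
    refine (integral_tsum_of_summable_integral_norm (hint t) ?_).symm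
    simp_rw [Real.norm_of_nonneg (hterm0 t _ _), hval]
    exact hpsum t
  have hZF : ∀ ω t, Z ω t v = F t (ξ ω) - ∫ ω, F t (ξ ω) ∂μ := fun ω t => by
    rw [hZ, hmean, ← (hFsum t (ξ ω)).tsum_sub (hpsum t)]
    simp_rw [mul_sub]
  simp_rw [hZF, ← hmean]
  exact abs_integral_centered_mul_le (hFmeas u) (hFmeas u') (fun _ => hF0 _ _)
    (fun _ => hF0 _ _) (fun _ => hFK _ _) (fun _ => hFK _ _)
end
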